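/- Let Q and Q′ be normal coordinates for germs at 0 of real-analytic hypersurfaces M, M′ ⊂ ℂ², neither Levi-flat near 0, with invariants (α₀, μ₀) = (α₀′, μ₀′), and suppose there exists a local biholomorphism H : (ℂ²,0) → (ℂ²,0) satisfying the mapping identity for (Q,Q′). Then the order of vanishing at χ = 0 of the (not identically zero) holomorphic function q_{α₀μ₀}(χ) equals the order of vanishing at χ′ = 0 of q′_{α₀μ₀}(χ′); both orders are finite and at least 1. -/

import Mathlib

open Filter Topology Matrix

noncomputable section

/-- Complex conjugation as a plain function. -/
def cj : ℂ → ℂ := (starRingEnd ℂ)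

/-- Iterated partial derivative `∂_z^i ∂_w^j F (z, w)` of `F : ℂ → ℂ → ℂ`. -/
def pd (F : ℂ → ℂ → ℂ) (i j : ℕ) (z w : ℂ) : ℂ :=
  deriv^[i] (fun z' => deriv^[j] (F z') w) z

/-- `Q` is a normal-coordinates defining function (near `0`) of a germ of a
real-analytic hypersurface in `ℂ²`. -/
def IsNormalCoord (Q : ℂ → ℂ → ℂ → ℂ) : Prop :=
  AnalyticAt ℂ (fun p : ℂ × ℂ × ℂ => Q p.1 p.2.1 p.2.2) 0 ∧
  (∀ᶠ p : ℂ × ℂ in 𝓝 0, Q p.1 0 p.2 = p.2) ∧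
  (∀ᶠ p : ℂ × ℂ in 𝓝 0, Q 0 p.1 p.2 = p.2) ∧
  (∀ᶠ p : ℂ × ℂ × ℂ in 𝓝 0, Q p.1 p.2.1 (cj (Q (cj p.2.1) (cj p.1) (cj p.2.2))) = p.2.2)

/-- The mapping identity expressing that the germ at `0` of the holomorphic map
`H = (F, G)` (with `H(0) = 0`) sends the hypersurface defined by `Q` into the one
defined by `Q'`. -/
def SendsInto (Q Q' : ℂ → ℂ → ℂ → ℂ) (F G : ℂ → ℂ → ℂ) : Prop :=
  AnalyticAt ℂ (fun p : ℂ × ℂ => F p.1 p.2) 0 ∧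
  AnalyticAt ℂ (fun p : ℂ × ℂ => G p.1 p.2) 0 ∧
  F 0 0 = 0 ∧ G 0 0 = 0 ∧
  ∀ᶠ p : ℂ × ℂ × ℂ in 𝓝 0,
    G p.1 (Q p.1 p.2.1 p.2.2) =
      Q' (F p.1 (Q p.1 p.2.1 p.2.2)) (cj (F (cj p.2.1) (cj p.2.2))) (cj (G (cj p.2.1) (cj p.2.2)))

/-- Determinant of the Jacobian matrix of `H = (F, G)` at `0`. -/
def JacDet (F G : ℂ → ℂ → ℂ) : ℂ :=
  pd F 1 0 0 0 * pd G 0 1 0 0 - pd F 0 1 0 0 * pd G 1 0 0 0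

/-- The hypersurface defined by `Q` is not Levi-flat near `0`, i.e. `Q(z,χ,τ) ≢ τ`. -/
def NotLeviFlat (Q : ℂ → ℂ → ℂ → ℂ) : Prop :=
  ¬ ∀ᶠ p : ℂ × ℂ × ℂ in 𝓝 0, Q p.1 p.2.1 p.2.2 = p.2.2

/-- The hypersurface defined by `Q` is of finite type at `0`, i.e. `Q(z,χ,0) ≢ 0`. -/
def FiniteTypeAt (Q : ℂ → ℂ → ℂ → ℂ) : Prop :=
  ¬ ∀ᶠ p : ℂ × ℂ in 𝓝 0, Q p.1 p.2 0 = 0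

/-- `q_{αμ}(χ) = ∂_z^α ∂_τ^μ Q(0, χ, 0)`. -/
def qd (Q : ℂ → ℂ → ℂ → ℂ) (α μ : ℕ) (χ : ℂ) : ℂ :=
  deriv^[α] (fun z => deriv^[μ] (fun τ => Q z χ τ) 0) 0

/-- The hypersurface (germ) defined by `Q` as a subset of `ℂ²`. -/
def MSet (Q : ℂ → ℂ → ℂ → ℂ) : Set (ℂ × ℂ) := {p | p.2 = Q p.1 (cj p.1) (cj p.2)}


/-- `q_{αμ} ≢ 0` as a germ at `0`. -/
def QNontriv (Q : ℂ → ℂ → ℂ → ℂ) (α μ : ℕ) : Prop :=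
  ¬ ∀ᶠ χ : ℂ in 𝓝 0, qd Q α μ χ = 0

/-- `(α₀, μ₀)` are the invariants of the (non-Levi-flat) hypersurface defined by `Q`. -/
def IsInvariants (Q : ℂ → ℂ → ℂ → ℂ) (α₀ μ₀ : ℕ) : Prop :=
  1 ≤ α₀ ∧ QNontriv Q α₀ μ₀ ∧
  (∀ α μ : ℕ, 1 ≤ α → QNontriv Q α μ → α₀ + μ₀ ≤ α + μ) ∧
  (∀ α μ : ℕ, 1 ≤ α → QNontriv Q α μ → α + μ = α₀ + μ₀ → μ₀ ≤ μ)

lemma analyticAt_deriv_fst {E : Type*} [NormedAddCommGroup E] [NormedSpace ℂ E]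
    {f : ℂ → E → ℂ} {p : ℂ × E} (hf : AnalyticAt ℂ (fun p : ℂ × E => f p.1 p.2) p) :
    AnalyticAt ℂ (fun p : ℂ × E => deriv (fun x => f x p.2) p.1) p := by
  have h1 : AnalyticAt ℂ
      (fun p : ℂ × E => fderiv ℂ (fun p : ℂ × E => f p.1 p.2) p (1, 0)) p :=
    ((ContinuousLinearMap.apply ℂ ℂ ((1, 0) : ℂ × E)).analyticAt _).comp hf.fderiv
  refine h1.congr ?_
  filter_upwards [hf.eventually_analyticAt] with q hq
  have h2 : HasDerivAt (fun x : ℂ => ((x, q.2) : ℂ × E)) (1, 0) q.1 :=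
    (hasDerivAt_id q.1).prodMk (hasDerivAt_const q.1 q.2)
  exact (hq.differentiableAt.hasFDerivAt.comp_hasDerivAt q.1 h2).deriv.symm

lemma analyticAt_iterate_deriv_fst {E : Type*} [NormedAddCommGroup E] [NormedSpace ℂ E]
    (n : ℕ) {f : ℂ → E → ℂ} {p : ℂ × E} (hf : AnalyticAt ℂ (fun p : ℂ × E => f p.1 p.2) p) :
    AnalyticAt ℂ (fun p : ℂ × E => deriv^[n] (fun x => f x p.2) p.1) p := by
  induction n generalizing f with
  | zero => exact hf
  | succ n ih => exact ih (f := fun x e => deriv (fun x => f x e) x) (analyticAt_deriv_fst hf)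

lemma analyticAt_iterate_deriv_zero {E : Type*} [NormedAddCommGroup E] [NormedSpace ℂ E]
    (n : ℕ) {f : ℂ → E → ℂ} {e : E} (hf : AnalyticAt ℂ (fun p : ℂ × E => f p.1 p.2) (0, e)) :
    AnalyticAt ℂ (fun e : E => deriv^[n] (fun x => f x e) 0) e :=
  (analyticAt_iterate_deriv_fst n hf).curry_right

/-- Taylor expansion in the first variable with a remainder that is uniform in the parameter. -/
lemma exists_norm_sub_taylor_le {E : Type*} [NormedAddCommGroup E] [NormedSpace ℂ E]
    (n : ℕ) {f : ℂ → E → ℂ} {e : E} (hf : AnalyticAt ℂ (fun p : ℂ × E => f p.1 p.2) (0, e)) :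
    ∃ C : ℝ, ∀ᶠ p : ℂ × E in 𝓝 (0, e),
      ‖f p.1 p.2 - ∑ k ∈ Finset.range n,
        deriv^[k] (fun x => f x p.2) 0 / (k.factorial : ℂ) * p.1 ^ k‖ ≤ C * ‖p.1‖ ^ n := by
  induction n generalizing f with
  | zero =>
    refine ⟨‖f 0 e‖ + 1, ?_⟩
    have := hf.continuousAt.norm.eventually_lt continuousAt_const
      (show ‖f 0 e‖ < ‖f 0 e‖ + 1 by linarith)
    filter_upwards [this] with p hp
    simpa using hp.le
  | succ n ih =>
    obtain ⟨C, hC⟩ := ih (f := fun x e => deriv (fun x => f x e) x) (analyticAt_deriv_fst hf)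
    refine ⟨C, ?_⟩
    obtain ⟨ε, hε, hb⟩ := Metric.eventually_nhds_iff_ball.1 (hC.and hf.eventually_analyticAt)
    refine Metric.eventually_nhds_iff_ball.2 ⟨ε, hε, ?_⟩
    rintro ⟨x, a⟩ hxa
    rw [← ball_prod_same] at hb hxa
    obtain ⟨hx, ha⟩ := hxa
    simp only [mem_ball_zero_iff] at hx
    set c : ℕ → ℂ := fun k => deriv^[k] (fun x => f x a) 0 with hc
    set h : ℂ → ℂ := fun y => f y a - ∑ k ∈ Finset.range (n + 1),
      c k / (k.factorial : ℂ) * y ^ k with hh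
    have hd : ∀ y ∈ Metric.closedBall (0 : ℂ) ‖x‖, HasDerivAt h
        (deriv (fun x => f x a) y - ∑ k ∈ Finset.range n,
          c (k + 1) / (k.factorial : ℂ) * y ^ k) y := by
      intro y hy
      have hy' : (y, a) ∈ Metric.ball (0 : ℂ) ε ×ˢ Metric.ball e ε :=
        ⟨by simp only [mem_ball_zero_iff, mem_closedBall_zero_iff] at hy ⊢; linarith, ha⟩
      have hfa : DifferentiableAt ℂ (fun x => f x a) y :=
        (hb _ hy').2.curry_left.differentiableAt
      refine hfa.hasDerivAt.sub ?_
      simp only [Finset.sum_range_succ']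
      have : ∀ k ∈ Finset.range n, HasDerivAt
          (fun y : ℂ => c (k + 1) / ((k + 1).factorial : ℂ) * y ^ (k + 1))
          (c (k + 1) / (k.factorial : ℂ) * y ^ k) y := by
        intro k _
        refine ((hasDerivAt_pow (k + 1) y).const_mul _).congr_deriv ?_
        have h1 : ((k : ℂ) + 1) ≠ 0 := Nat.cast_add_one_ne_zero k
        have h2 : (k.factorial : ℂ) ≠ 0 := by exact_mod_cast k.factorial_ne_zero
        rw [Nat.factorial_succ]
        push_cast
        field_simp
      have h3 := (HasDerivAt.fun_sum this).add_const (c 0 / (Nat.factorial 0 : ℂ) * 1)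
      simpa using h3
    have hbd : ∀ y ∈ Metric.closedBall (0 : ℂ) ‖x‖,
        ‖deriv (fun x => f x a) y - ∑ k ∈ Finset.range n,
          c (k + 1) / (k.factorial : ℂ) * y ^ k‖ ≤ C * ‖x‖ ^ n := by
      intro y hy
      have hyx : ‖y‖ ≤ ‖x‖ := by simpa using hy
      have hy' : (y, a) ∈ Metric.ball (0 : ℂ) ε ×ˢ Metric.ball e ε :=
        ⟨by simp only [mem_ball_zero_iff]; linarith, ha⟩
      have h1 := (hb _ hy').1
      have hx' : (x, a) ∈ Metric.ball (0 : ℂ) ε ×ˢ Metric.ball e ε :=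
        ⟨by simpa using hx, ha⟩
      have h2 := (norm_nonneg _).trans (hb _ hx').1
      refine le_trans h1 ?_
      rcases eq_or_ne x 0 with rfl | hx0
      · have : y = 0 := by simpa using hyx
        simp [this]
      · have hC0 : 0 ≤ C := by
          by_contra hneg
          have : 0 < ‖x‖ ^ n := by positivity
          simp only at h2
          nlinarith
        gcongr
    have key := (convex_closedBall (0 : ℂ) ‖x‖).norm_image_sub_le_of_norm_hasDerivWithin_le
      (fun y hy => (hd y hy).hasDerivWithinAt) hbd
      (Metric.mem_closedBall_self (norm_nonneg x)) (by simp : x ∈ Metric.closedBall (0 : ℂ) ‖x‖)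
    have h0 : h 0 = 0 := by
      simp [hh, hc, Finset.sum_range_succ']
    rw [h0, sub_zero, sub_zero, mul_assoc, ← pow_succ] at key
    exact key

lemma tendsto_monomial_of_lt {zs ts : ℂ → ℂ} {A B : ℂ} {N N' : ℕ} {α μ D : ℕ}
    (hz : Tendsto (fun s => zs s / s ^ N) (𝓝[≠] 0) (𝓝 A))
    (ht : Tendsto (fun s => ts s / s ^ N') (𝓝[≠] 0) (𝓝 B)) (hD : D < N * α + N' * μ) :
    Tendsto (fun s => zs s ^ α * ts s ^ μ / s ^ D) (𝓝[≠] 0) (𝓝 0) := by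
  obtain ⟨k, hk⟩ := Nat.exists_eq_add_of_lt hD
  have h0 : Tendsto (fun s : ℂ => s ^ (k + 1)) (𝓝[≠] 0) (𝓝 0) := by
    have : Tendsto (fun s : ℂ => s ^ (k + 1)) (𝓝 0) (𝓝 (0 ^ (k + 1))) :=
      (continuous_pow (k + 1)).tendsto 0
    simpa using this.mono_left nhdsWithin_le_nhds
  have h1 := ((hz.pow α).mul (ht.pow μ)).mul h0
  rw [mul_zero] at h1
  refine h1.congr' ?_
  filter_upwards [self_mem_nhdsWithin] with s hs
  have hs : s ≠ 0 := hs
  rw [div_pow, div_pow, div_mul_div_comm, ← pow_mul, ← pow_mul, ← pow_add, hk, add_assoc, pow_add]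
  field_simp

lemma tendsto_monomial_of_eq {zs ts : ℂ → ℂ} {A B : ℂ} {N N' : ℕ} {α μ D : ℕ}
    (hz : Tendsto (fun s => zs s / s ^ N) (𝓝[≠] 0) (𝓝 A))
    (ht : Tendsto (fun s => ts s / s ^ N') (𝓝[≠] 0) (𝓝 B)) (hD : D = N * α + N' * μ) :
    Tendsto (fun s => zs s ^ α * ts s ^ μ / s ^ D) (𝓝[≠] 0) (𝓝 (A ^ α * B ^ μ)) := by
  refine ((hz.pow α).mul (ht.pow μ)).congr fun s => ?_
  rw [div_pow, div_pow, div_mul_div_comm, ← pow_mul, ← pow_mul, ← pow_add, hD]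

lemma tendsto_zero_of_tendsto_div_pow {zs : ℂ → ℂ} {A : ℂ} {N : ℕ} (hN : N ≠ 0)
    (hz : Tendsto (fun s => zs s / s ^ N) (𝓝[≠] 0) (𝓝 A)) : Tendsto zs (𝓝[≠] 0) (𝓝 0) := by
  have := tendsto_monomial_of_lt (α := 1) (μ := 0) (D := 0) hz hz (by omega)
  simpa using this

lemma analyticAt_rotate {Q : ℂ → ℂ → ℂ → ℂ}
    (hQ : AnalyticAt ℂ (fun p : ℂ × ℂ × ℂ => Q p.1 p.2.1 p.2.2) 0) :
    AnalyticAt ℂ (fun p : ℂ × ℂ × ℂ => Q p.2.1 p.2.2 p.1) (0, (0, 0)) := by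
  let L : ℂ × ℂ × ℂ →L[ℂ] ℂ × ℂ × ℂ :=
    ((ContinuousLinearMap.fst ℂ ℂ ℂ).comp (ContinuousLinearMap.snd ℂ ℂ (ℂ × ℂ))).prod
      (((ContinuousLinearMap.snd ℂ ℂ ℂ).comp (ContinuousLinearMap.snd ℂ ℂ (ℂ × ℂ))).prod
        (ContinuousLinearMap.fst ℂ ℂ (ℂ × ℂ)))
  exact hQ.comp_of_eq (L.analyticAt (0, (0, 0))) rfl

lemma analyticAt_qd {Q : ℂ → ℂ → ℂ → ℂ}
    (hQ : AnalyticAt ℂ (fun p : ℂ × ℂ × ℂ => Q p.1 p.2.1 p.2.2) 0) (α μ : ℕ) :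
    AnalyticAt ℂ (fun p : ℂ × ℂ => deriv^[μ] (fun τ => Q p.1 p.2 τ) 0) (0, 0) ∧
      AnalyticAt ℂ (qd Q α μ) 0 := by
  have h1 := analyticAt_rotate hQ
  have h3 := analyticAt_iterate_deriv_zero μ (f := fun τ (p : ℂ × ℂ) => Q p.1 p.2 τ) h1
  exact ⟨h3, analyticAt_iterate_deriv_zero α
    (f := fun z χ => deriv^[μ] (fun τ => Q z χ τ) 0) h3⟩

/-- Taylor expansion in `(z, τ)` with coefficients `qd`, uniformly in `χ`. -/
lemma exists_norm_sub_qd_sum_le {Q : ℂ → ℂ → ℂ → ℂ}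
    (hQ : AnalyticAt ℂ (fun p : ℂ × ℂ × ℂ => Q p.1 p.2.1 p.2.2) 0) (n : ℕ) :
    ∃ C : ℝ, ∀ᶠ p : ℂ × ℂ × ℂ in 𝓝 0,
      ‖Q p.1 p.2.1 p.2.2 - ∑ μ ∈ Finset.range n, (∑ α ∈ Finset.range n,
        qd Q α μ p.2.1 / (α.factorial : ℂ) * p.1 ^ α) / (μ.factorial : ℂ) * p.2.2 ^ μ‖
        ≤ C * (‖p.1‖ ^ n + ‖p.2.2‖ ^ n) := by
  have h1 := analyticAt_rotate hQ
  obtain ⟨C, hC⟩ := exists_norm_sub_taylor_le n (f := fun τ (p : ℂ × ℂ) => Q p.1 p.2 τ) h1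
  have h4 : ∀ μ : ℕ, ∃ c : ℝ, ∀ᶠ p : ℂ × ℂ in 𝓝 (0, 0),
      ‖deriv^[μ] (fun τ => Q p.1 p.2 τ) 0 - ∑ α ∈ Finset.range n,
        qd Q α μ p.2 / (α.factorial : ℂ) * p.1 ^ α‖ ≤ c * ‖p.1‖ ^ n := fun μ =>
    exists_norm_sub_taylor_le n (f := fun z χ => deriv^[μ] (fun τ => Q z χ τ) 0)
      (analyticAt_qd hQ 0 μ).1
  choose c hc using h4
  have t1 : Tendsto (fun p : ℂ × ℂ × ℂ => ((p.2.2, (p.1, p.2.1)) : ℂ × ℂ × ℂ))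
      (𝓝 0) (𝓝 (0, (0, 0))) :=
    Continuous.tendsto' (by fun_prop) _ _ rfl
  have t2 : Tendsto (fun p : ℂ × ℂ × ℂ => ((p.1, p.2.1) : ℂ × ℂ)) (𝓝 0) (𝓝 (0, 0)) :=
    Continuous.tendsto' (by fun_prop) _ _ rfl
  have t3 : ∀ᶠ p : ℂ × ℂ × ℂ in 𝓝 0, ‖p.2.2‖ < 1 :=
    ContinuousAt.eventually_lt (by fun_prop) continuousAt_const (by simp)
  have h5 : ∀ᶠ p : ℂ × ℂ × ℂ in 𝓝 0, ∀ μ ∈ Finset.range n,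
      ‖deriv^[μ] (fun τ => Q p.1 p.2.1 τ) 0 - ∑ α ∈ Finset.range n,
        qd Q α μ p.2.1 / (α.factorial : ℂ) * p.1 ^ α‖ ≤ c μ * ‖p.1‖ ^ n :=
    (Finset.eventually_all _).2 fun μ _ => t2.eventually (hc μ)
  refine ⟨|C| + ∑ μ ∈ Finset.range n, |c μ|, ?_⟩
  filter_upwards [t1.eventually hC, h5, t3] with p hp1 hp2 hp3
  have e1 : ‖∑ μ ∈ Finset.range n, deriv^[μ] (fun τ => Q p.1 p.2.1 τ) 0 / (μ.factorial : ℂ)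
        * p.2.2 ^ μ - ∑ μ ∈ Finset.range n, (∑ α ∈ Finset.range n,
        qd Q α μ p.2.1 / (α.factorial : ℂ) * p.1 ^ α) / (μ.factorial : ℂ) * p.2.2 ^ μ‖
        ≤ (∑ μ ∈ Finset.range n, |c μ|) * ‖p.1‖ ^ n := by
    rw [← Finset.sum_sub_distrib, Finset.sum_mul]
    refine norm_sum_le_of_le _ fun μ hμ => ?_
    rw [← sub_mul, ← sub_div, norm_mul, norm_div, norm_pow]
    have f1 : (1 : ℝ) ≤ ‖(μ.factorial : ℂ)‖ := by
      rw [Complex.norm_natCast]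
      exact_mod_cast Nat.succ_le_of_lt μ.factorial_pos
    calc _ ≤ ‖deriv^[μ] (fun τ => Q p.1 p.2.1 τ) 0 - ∑ α ∈ Finset.range n,
          qd Q α μ p.2.1 / (α.factorial : ℂ) * p.1 ^ α‖ * 1 :=
          mul_le_mul (div_le_self (norm_nonneg _) f1)
            (pow_le_one₀ (norm_nonneg _) hp3.le) (by positivity) (by positivity)
      _ ≤ c μ * ‖p.1‖ ^ n := by rw [mul_one]; exact hp2 μ hμ
      _ ≤ |c μ| * ‖p.1‖ ^ n := by gcongr; exact le_abs_self _
  have e2 : C * ‖p.2.2‖ ^ n ≤ |C| * ‖p.2.2‖ ^ n := by gcongr; exact le_abs_self _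
  have e3 : 0 ≤ |C| * ‖p.1‖ ^ n := by positivity
  have e4 : 0 ≤ (∑ μ ∈ Finset.range n, |c μ|) * ‖p.2.2‖ ^ n := by positivity
  have := norm_sub_le_norm_sub_add_norm_sub (Q p.1 p.2.1 p.2.2)
    (∑ μ ∈ Finset.range n, deriv^[μ] (fun τ => Q p.1 p.2.1 τ) 0 / (μ.factorial : ℂ)
        * p.2.2 ^ μ) (∑ μ ∈ Finset.range n, (∑ α ∈ Finset.range n,
        qd Q α μ p.2.1 / (α.factorial : ℂ) * p.1 ^ α) / (μ.factorial : ℂ) * p.2.2 ^ μ)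
  nlinarith

/-- The version of `exists_norm_sub_qd_sum_le` for the difference `Q z χ τ - Q 0 χ τ`. -/
lemma exists_norm_sub_sub_qd_sum_le {Q : ℂ → ℂ → ℂ → ℂ}
    (hQ : AnalyticAt ℂ (fun p : ℂ × ℂ × ℂ => Q p.1 p.2.1 p.2.2) 0) (m : ℕ) :
    ∃ C : ℝ, ∀ᶠ p : ℂ × ℂ × ℂ in 𝓝 0,
      ‖Q p.1 p.2.1 p.2.2 - Q 0 p.2.1 p.2.2 -
        ∑ μ ∈ Finset.range (m + 1), (∑ α ∈ Finset.range m,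
        qd Q (α + 1) μ p.2.1 / ((α + 1).factorial : ℂ) * p.1 ^ (α + 1)) / (μ.factorial : ℂ)
          * p.2.2 ^ μ‖ ≤ C * (‖p.1‖ ^ (m + 1) + ‖p.2.2‖ ^ (m + 1)) := by
  obtain ⟨C, hC⟩ := exists_norm_sub_qd_sum_le hQ (m + 1)
  have t1 : Tendsto (fun p : ℂ × ℂ × ℂ => ((0, p.2.1, p.2.2) : ℂ × ℂ × ℂ)) (𝓝 0) (𝓝 0) :=
    Continuous.tendsto' (by fun_prop) _ _ rfl
  refine ⟨|C| + |C|, ?_⟩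
  filter_upwards [hC, t1.eventually hC] with p h1 h2
  simp only [Finset.sum_range_succ', norm_zero] at h1 h2 ⊢
  have e1 : C * (‖p.1‖ ^ (m + 1) + ‖p.2.2‖ ^ (m + 1))
      ≤ |C| * (‖p.1‖ ^ (m + 1) + ‖p.2.2‖ ^ (m + 1)) := by gcongr; exact le_abs_self _
  have e2 : C * ‖p.2.2‖ ^ (m + 1) ≤ |C| * ‖p.2.2‖ ^ (m + 1) := by gcongr; exact le_abs_self _
  have e3 : 0 ≤ |C| * ‖p.1‖ ^ (m + 1) := by positivity
  have h3 := norm_sub_le_of_le h1 h2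
  simp only [pow_zero, mul_one, ne_eq, Nat.add_eq_zero_iff, one_ne_zero, and_false,
    not_false_eq_true, zero_pow, mul_zero, Finset.sum_const_zero, zero_add, add_div, add_mul,
    Finset.sum_add_distrib] at h3 ⊢
  refine le_trans (le_of_eq ?_) (h3.trans ?_)
  · congr 1
    ring
  · linarith

lemma eventually_slice {P : ℂ × ℂ × ℂ → Prop} (h : ∀ᶠ p in 𝓝 0, P p) :
    ∀ᶠ χ : ℂ in 𝓝 0, ∀ᶠ p in 𝓝 (0, χ, 0), P p := by
  have t1 : Tendsto (fun χ : ℂ => ((0, χ, 0) : ℂ × ℂ × ℂ)) (𝓝 0) (𝓝 0) :=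
    Continuous.tendsto' (by fun_prop) _ _ rfl
  exact t1.eventually (eventually_eventually_nhds.2 h)

/-- Along weighted curves the monomial `z ^ α₀ * τ ^ μ₀` dominates `Q z χ τ - τ`. -/
lemma IsInvariants.eventually_tendsto {Q : ℂ → ℂ → ℂ → ℂ} (hQ : IsNormalCoord Q) {α₀ μ₀ : ℕ}
    (hI : IsInvariants Q α₀ μ₀) :
    ∀ᶠ χ₀ : ℂ in 𝓝 0, ∀ (zs χs ts : ℂ → ℂ) (A B : ℂ),
      Tendsto χs (𝓝[≠] 0) (𝓝 χ₀) →
      Tendsto (fun s => zs s / s ^ (μ₀ + 1)) (𝓝[≠] 0) (𝓝 A) →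
      Tendsto (fun s => ts s / s ^ (μ₀ + 2)) (𝓝[≠] 0) (𝓝 B) →
      Tendsto (fun s => (Q (zs s) (χs s) (ts s) - ts s) /
          s ^ ((μ₀ + 1) * α₀ + (μ₀ + 2) * μ₀)) (𝓝[≠] 0)
        (𝓝 (qd Q α₀ μ₀ χ₀ / (α₀.factorial : ℂ) / (μ₀.factorial : ℂ) * (A ^ α₀ * B ^ μ₀))) := by
  obtain ⟨hα₀, hnt, hmin, hmin'⟩ := hI
  set m := α₀ + μ₀ with hm
  set D := (μ₀ + 1) * α₀ + (μ₀ + 2) * μ₀ with hD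
  have hDm : D = (μ₀ + 1) * m + μ₀ := by rw [hD, hm]; ring
  obtain ⟨C, hC⟩ := exists_norm_sub_sub_qd_sum_le hQ.1 m
  have hz0 : ∀ᶠ p : ℂ × ℂ × ℂ in 𝓝 0, Q 0 p.2.1 p.2.2 = p.2.2 := by
    have t1 : Tendsto (fun p : ℂ × ℂ × ℂ => p.2) (𝓝 0) (𝓝 0) :=
      Continuous.tendsto' (by fun_prop) _ _ rfl
    exact t1.eventually hQ.2.2.1
  have E1 : ∀ᶠ χ₀ : ℂ in 𝓝 0, ∀ μ ∈ Finset.range (m + 1), ∀ α ∈ Finset.range m,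
      ContinuousAt (qd Q (α + 1) μ) χ₀ ∧
        (¬ QNontriv Q (α + 1) μ → ∀ᶠ χ in 𝓝 χ₀, qd Q (α + 1) μ χ = 0) := by
    refine (Finset.eventually_all _).2 fun μ _ => (Finset.eventually_all _).2 fun α _ => ?_
    refine ((analyticAt_qd hQ.1 (α + 1) μ).2.eventually_analyticAt.mono
      fun χ h => h.continuousAt).and ?_
    by_cases hq : QNontriv Q (α + 1) μ
    · exact Eventually.of_forall fun χ h => absurd hq h
    · have hq' := hq
      rw [QNontriv, not_not] at hq'
      exact (eventually_eventually_nhds.2 hq').mono fun χ h _ => h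
  filter_upwards [eventually_slice (hC.and hz0), E1] with χ₀ h1 h2 zs χs ts A B hχ hz ht
  have hzz := tendsto_zero_of_tendsto_div_pow (by omega) hz
  have htt := tendsto_zero_of_tendsto_div_pow (by omega) ht
  have h3 := (hzz.prodMk_nhds (hχ.prodMk_nhds htt)).eventually h1
  have herr : Tendsto (fun s => (Q (zs s) (χs s) (ts s) - ts s -
      ∑ μ ∈ Finset.range (m + 1), (∑ α ∈ Finset.range m,
        qd Q (α + 1) μ (χs s) / ((α + 1).factorial : ℂ) * zs s ^ (α + 1)) / (μ.factorial : ℂ)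
          * ts s ^ μ) / s ^ D) (𝓝[≠] 0) (𝓝 0) := by
    have g1 := tendsto_monomial_of_lt (α := m + 1) (μ := 0) (D := D) hz ht
      (by rw [hDm]; nlinarith)
    have g2 := tendsto_monomial_of_lt (α := 0) (μ := m + 1) (D := D) hz ht
      (by rw [hDm]; nlinarith)
    have g3 := (g1.norm.add g2.norm).const_mul C
    simp only [norm_zero, add_zero, mul_zero] at g3
    refine squeeze_zero_norm' ?_ g3
    filter_upwards [h3] with s hs
    obtain ⟨hs1, hs2⟩ := hs
    rw [hs2] at hs1
    simp only [pow_zero, mul_one, one_mul, norm_div, norm_pow]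
    rw [← add_div, ← mul_div_assoc]
    gcongr
  have hterm : ∀ μ ∈ Finset.range (m + 1), ∀ α ∈ Finset.range m,
      Tendsto (fun s => qd Q (α + 1) μ (χs s) / ((α + 1).factorial : ℂ) / (μ.factorial : ℂ) *
        (zs s ^ (α + 1) * ts s ^ μ / s ^ D)) (𝓝[≠] 0)
        (𝓝 (if μ = μ₀ then if α = α₀ - 1 then
          qd Q α₀ μ₀ χ₀ / (α₀.factorial : ℂ) / (μ₀.factorial : ℂ) * (A ^ α₀ * B ^ μ₀)
          else 0 else 0)) := by
    intro μ hμ α hα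
    obtain ⟨hc, hn⟩ := h2 μ hμ α hα
    have hq : Tendsto (fun s => qd Q (α + 1) μ (χs s) / ((α + 1).factorial : ℂ) /
        (μ.factorial : ℂ)) (𝓝[≠] 0) (𝓝 (qd Q (α + 1) μ χ₀ / ((α + 1).factorial : ℂ) /
        (μ.factorial : ℂ))) := ((hc.tendsto.comp hχ).div_const _).div_const _
    by_cases heq : μ = μ₀ ∧ α = α₀ - 1
    · obtain ⟨rfl, rfl⟩ := heq
      have e : α₀ - 1 + 1 = α₀ := by omega
      simp only [if_true]
      rw [e] at hq ⊢
      exact hq.mul (tendsto_monomial_of_eq hz ht rfl)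
    · have hif : (if μ = μ₀ then if α = α₀ - 1 then
          qd Q α₀ μ₀ χ₀ / (α₀.factorial : ℂ) / (μ₀.factorial : ℂ) * (A ^ α₀ * B ^ μ₀)
          else 0 else 0) = 0 := by
        split_ifs with ha hb
        · exact absurd ⟨ha, hb⟩ heq
        · rfl
        · rfl
      rw [hif]
      by_cases hnt' : QNontriv Q (α + 1) μ
      · have g := hmin (α + 1) μ (by omega) hnt'
        have hlt : D < (μ₀ + 1) * (α + 1) + (μ₀ + 2) * μ := by
          have e : (μ₀ + 1) * (α + 1) + (μ₀ + 2) * μ = (μ₀ + 1) * (α + 1 + μ) + μ := by ring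
          rw [e, hDm]
          rcases eq_or_lt_of_le g with g' | g'
          · have := hmin' (α + 1) μ (by omega) hnt' (by omega)
            have hne : μ ≠ μ₀ := fun hμ' => heq ⟨hμ', by omega⟩
            rw [← g']
            omega
          · nlinarith
        simpa using hq.mul (tendsto_monomial_of_lt hz ht hlt)
      · refine tendsto_const_nhds.congr' ?_
        filter_upwards [hχ.eventually (hn hnt')] with s hs
        simp [hs]
  have hsum := tendsto_finsetSum (Finset.range (m + 1)) fun μ hμ =>
    tendsto_finsetSum (Finset.range m) fun α hα => hterm μ hμ α hα
  have hμm : μ₀ ∈ Finset.range (m + 1) := Finset.mem_range.2 (by omega)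
  have hαm : α₀ - 1 ∈ Finset.range m := Finset.mem_range.2 (by omega)
  have hval : ∀ v : ℂ, (∑ μ ∈ Finset.range (m + 1), ∑ α ∈ Finset.range m,
      if μ = μ₀ then if α = α₀ - 1 then v else 0 else 0) = v := by
    intro v
    rw [Finset.sum_eq_single_of_mem μ₀ hμm (by intro b _ hb; simp [hb])]
    simp only [if_true]
    rw [Finset.sum_ite_eq' , if_pos hαm]
  rw [hval] at hsum
  have := herr.add hsum
  rw [zero_add] at this
  refine this.congr fun s => ?_
  rw [sub_div, Finset.sum_div, sub_add_eq_add_sub, add_sub_assoc, add_eq_left, sub_eq_zero]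
  refine Finset.sum_congr rfl fun μ _ => ?_
  rw [Finset.sum_div, Finset.sum_mul, Finset.sum_div]
  refine Finset.sum_congr rfl fun α _ => ?_
  ring

lemma qd_zero {Q : ℂ → ℂ → ℂ → ℂ} (hQ : IsNormalCoord Q) {α : ℕ} (hα : 1 ≤ α) (μ : ℕ) :
    qd Q α μ 0 = 0 := by
  have h1 : ∀ᶠ z : ℂ in 𝓝 0, ∀ᶠ τ : ℂ in 𝓝 0, Q z 0 τ = τ := by
    have := hQ.2.1
    rw [← Prod.mk_zero_zero, nhds_prod_eq] at this
    exact this.curry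
  have h2 : (fun z => deriv^[μ] (fun τ => Q z 0 τ) 0) =ᶠ[𝓝 0]
      fun _ => deriv^[μ] (fun τ => τ) 0 := by
    filter_upwards [h1] with z hz
    have : (fun τ => Q z 0 τ) =ᶠ[𝓝 0] fun τ => τ := hz
    simpa only [iteratedDeriv_eq_iterate] using this.iteratedDeriv_eq μ
  have h3 := h2.iteratedDeriv_eq α
  rw [qd, ← iteratedDeriv_eq_iterate, h3, iteratedDeriv_const, if_neg (by omega)]

lemma HasFDerivAt.tendsto_div_pow {E : Type*} [NormedAddCommGroup E] [NormedSpace ℂ E]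
    {f : E → ℂ} {f' : E →L[ℂ] ℂ} {x v : E} (hf : HasFDerivAt f f' x) (hx : f x = 0)
    {d : ℂ → E} {N : ℕ} (hd0 : Tendsto d (𝓝[≠] 0) (𝓝 0))
    (hd : Tendsto (fun s => (s ^ N)⁻¹ • d s) (𝓝[≠] 0) (𝓝 v)) :
    Tendsto (fun s => f (x + d s) / s ^ N) (𝓝[≠] 0) (𝓝 (f' v)) := by
  have := (hasFDerivWithinAt_univ.2 hf).lim hd0 (Eventually.of_forall fun _ => Set.mem_univ _) hd
  refine this.congr fun s => ?_
  rw [hx, sub_zero, smul_eq_mul, div_eq_inv_mul]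

lemma tendsto_pow_punctured {n : ℕ} (hn : n ≠ 0) :
    Tendsto (fun s : ℂ => s ^ n) (𝓝[≠] 0) (𝓝 0) :=
  ((continuous_pow n).tendsto' 0 0 (by simp [hn])).mono_left nhdsWithin_le_nhds

lemma tendsto_pow_div_pow (N : ℕ) :
    Tendsto (fun s : ℂ => s ^ N / s ^ N) (𝓝[≠] 0) (𝓝 1) := by
  refine tendsto_const_nhds.congr' ?_
  filter_upwards [self_mem_nhdsWithin] with s hs
  exact (div_self (pow_ne_zero _ hs)).symm

lemma tendsto_pow_succ_div_pow (N : ℕ) :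
    Tendsto (fun s : ℂ => s ^ (N + 1) / s ^ N) (𝓝[≠] 0) (𝓝 0) := by
  refine (tendsto_id.mono_left nhdsWithin_le_nhds).congr' ?_
  filter_upwards [self_mem_nhdsWithin] with s hs
  rw [pow_succ, mul_div_cancel_left₀ _ (pow_ne_zero _ hs), id]

lemma HasStrictFDerivAt.tendsto_sub_div_pow {G : ℂ → ℂ → ℂ} {G' : ℂ × ℂ →L[ℂ] ℂ}
    (hG : HasStrictFDerivAt (fun p : ℂ × ℂ => G p.1 p.2) G' 0) {z u v : ℂ → ℂ} {D : ℕ} {ℓ : ℂ}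
    (hz : Tendsto z (𝓝[≠] 0) (𝓝 0)) (hu : Tendsto u (𝓝[≠] 0) (𝓝 0))
    (hv : Tendsto v (𝓝[≠] 0) (𝓝 0))
    (huv : Tendsto (fun s => (u s - v s) / s ^ D) (𝓝[≠] 0) (𝓝 ℓ)) :
    Tendsto (fun s => (G (z s) (u s) - G (z s) (v s)) / s ^ D) (𝓝[≠] 0)
      (𝓝 (G' (0, 1) * ℓ)) := by
  have h1 : Tendsto (fun s => ((z s, u s), (z s, v s))) (𝓝[≠] 0)
      (𝓝 ((0 : ℂ × ℂ), (0 : ℂ × ℂ))) :=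
    (hz.prodMk_nhds hu).prodMk_nhds (hz.prodMk_nhds hv)
  have h2 := hG.isLittleO.comp_tendsto h1
  have h3 : (fun s => u s - v s) =O[𝓝[≠] 0] (fun s => s ^ D) := by
    refine (huv.isBigO_one ℂ).mul (Asymptotics.isBigO_refl (fun s : ℂ => s ^ D) _) |>.congr' ?_ ?_
    · filter_upwards [self_mem_nhdsWithin] with s hs
      exact div_mul_cancel₀ _ (pow_ne_zero _ hs)
    · exact Eventually.of_forall fun s => one_mul _
  have h4 : (fun s => ((z s, u s) - (z s, v s) : ℂ × ℂ)) =O[𝓝[≠] 0] (fun s => s ^ D) := by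
    refine Asymptotics.IsBigO.trans (Asymptotics.isBigO_of_le _ fun s => ?_) h3
    simp [Prod.norm_def]
  have h5 := (h2.trans_isBigO h4).tendsto_div_nhds_zero
  have h6 := h5.add (huv.const_mul (G' (0, 1)))
  rw [zero_add] at h6
  refine h6.congr fun s => ?_
  have e : G' ((z s, u s) - (z s, v s)) = G' (0, 1) * (u s - v s) := by
    have : ((z s, u s) - (z s, v s) : ℂ × ℂ) = (u s - v s) • ((0, 1) : ℂ × ℂ) := by simp
    rw [this, map_smul, smul_eq_mul, mul_comm]
  simp only [Function.comp_apply]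
  rw [e]
  ring

lemma hasDerivAt_cj {f : ℂ → ℂ} {f' x : ℂ} (hf : HasDerivAt f f' (cj x)) :
    HasDerivAt (fun y => cj (f (cj y))) (cj f') x := by
  have := hf.conj_conj
  simpa [cj, Function.comp_def] using this

lemma continuous_cj : Continuous cj := Complex.continuous_conj

lemma cj_zero : cj 0 = 0 := map_zero _

lemma tendsto_cj_zero : Tendsto cj (𝓝 0) (𝓝 0) := continuous_cj.tendsto' _ _ cj_zero

lemma analyticAt_cj {f : ℂ → ℂ} (hf : AnalyticAt ℂ f 0) :
    AnalyticAt ℂ (fun y => cj (f (cj y))) 0 := by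
  rw [Complex.analyticAt_iff_eventually_differentiableAt] at hf ⊢
  exact (tendsto_cj_zero.eventually hf).mono fun y hy =>
    (hasDerivAt_cj hy.hasDerivAt).differentiableAt

lemma AnalyticAt.hasDerivAt_apply_fst {F : ℂ → ℂ → ℂ} {p : ℂ × ℂ}
    (hF : AnalyticAt ℂ (fun p : ℂ × ℂ => F p.1 p.2) p) :
    HasDerivAt (fun z => F z p.2) (fderiv ℂ (fun p : ℂ × ℂ => F p.1 p.2) p (1, 0)) p.1 := by
  have h : HasDerivAt (fun z : ℂ => ((z, p.2) : ℂ × ℂ)) (1, 0) p.1 :=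
    (hasDerivAt_id p.1).prodMk (hasDerivAt_const p.1 p.2)
  exact hF.differentiableAt.hasFDerivAt.comp_hasDerivAt p.1 h

lemma AnalyticAt.hasDerivAt_apply_snd {F : ℂ → ℂ → ℂ} {p : ℂ × ℂ}
    (hF : AnalyticAt ℂ (fun p : ℂ × ℂ => F p.1 p.2) p) :
    HasDerivAt (F p.1) (fderiv ℂ (fun p : ℂ × ℂ => F p.1 p.2) p (0, 1)) p.2 := by
  have h : HasDerivAt (fun w : ℂ => ((p.1, w) : ℂ × ℂ)) (0, 1) p.2 :=
    (hasDerivAt_const p.2 p.1).prodMk (hasDerivAt_id p.2)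
  exact hF.differentiableAt.hasFDerivAt.comp_hasDerivAt p.2 h

lemma SendsInto.eventually_apply_zero {Q Q' : ℂ → ℂ → ℂ → ℂ} (hQ : IsNormalCoord Q)
    (hQ' : IsNormalCoord Q') {F G : ℂ → ℂ → ℂ} (h : SendsInto Q Q' F G) :
    ∀ᶠ z : ℂ in 𝓝 0, G z 0 = 0 := by
  obtain ⟨hF, hG, hF0, hG0, hmap⟩ := h
  have t1 : Tendsto (fun z : ℂ => ((z, 0, 0) : ℂ × ℂ × ℂ)) (𝓝 0) (𝓝 0) :=
    Continuous.tendsto' (by fun_prop) _ _ rfl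
  have t2 : Tendsto (fun z : ℂ => ((z, 0) : ℂ × ℂ)) (𝓝 0) (𝓝 0) :=
    Continuous.tendsto' (by fun_prop) _ _ rfl
  have t3 : Tendsto (fun z : ℂ => ((F z 0, 0) : ℂ × ℂ)) (𝓝 0) (𝓝 0) := by
    have : Tendsto (fun z : ℂ => F z 0) (𝓝 0) (𝓝 0) := by
      have := hF.continuousAt.tendsto.comp t2
      simpa [hF0, Function.comp_def] using this
    exact this.prodMk_nhds tendsto_const_nhds
  filter_upwards [t1.eventually hmap, t2.eventually hQ.2.1, t3.eventually hQ'.2.1]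
    with z h1 h2 h3
  simpa [h2, cj_zero, hF0, hG0, h3] using h1

lemma JacDet_eq {F G : ℂ → ℂ → ℂ} (hF : AnalyticAt ℂ (fun p : ℂ × ℂ => F p.1 p.2) 0)
    (hG : AnalyticAt ℂ (fun p : ℂ × ℂ => G p.1 p.2) 0) (hG0 : ∀ᶠ z : ℂ in 𝓝 0, G z 0 = 0) :
    JacDet F G = fderiv ℂ (fun p : ℂ × ℂ => F p.1 p.2) 0 (1, 0) *
      fderiv ℂ (fun p : ℂ × ℂ => G p.1 p.2) 0 (0, 1) := by
  have h1 := (AnalyticAt.hasDerivAt_apply_fst hF).deriv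
  have h2 := (AnalyticAt.hasDerivAt_apply_snd hG).deriv
  have h3 : deriv (fun z => G z 0) 0 = 0 := by
    have : (fun z => G z 0) =ᶠ[𝓝 0] fun _ => 0 := hG0
    rw [this.deriv_eq, deriv_const]
  simp only [Prod.fst_zero, Prod.snd_zero] at h1 h2
  simp [JacDet, pd, h1, h2, h3]

/-- The transformation rule for `q_{α₀μ₀}` under a local biholomorphism. -/
lemma SendsInto.exists_qd_eq {Q Q' : ℂ → ℂ → ℂ → ℂ} (hQ : IsNormalCoord Q)
    (hQ' : IsNormalCoord Q') {α₀ μ₀ : ℕ} (hI : IsInvariants Q α₀ μ₀)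
    (hI' : IsInvariants Q' α₀ μ₀) {F G : ℂ → ℂ → ℂ} (h : SendsInto Q Q' F G)
    (hb : JacDet F G ≠ 0) :
    ∃ φ U : ℂ → ℂ, AnalyticAt ℂ φ 0 ∧ φ 0 = 0 ∧ deriv φ 0 ≠ 0 ∧ AnalyticAt ℂ U 0 ∧ U 0 ≠ 0 ∧
      ∀ᶠ χ in 𝓝 0, qd Q α₀ μ₀ χ = qd Q' α₀ μ₀ (φ χ) * U χ := by
  have hGz := h.eventually_apply_zero hQ hQ'
  obtain ⟨hF, hG, hF0, hG0, hmap⟩ := h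
  rw [JacDet_eq hF hG hGz] at hb
  have ha := left_ne_zero_of_mul hb
  have hd := right_ne_zero_of_mul hb
  set LF := fderiv ℂ (fun p : ℂ × ℂ => F p.1 p.2) 0
  set LG := fderiv ℂ (fun p : ℂ × ℂ => G p.1 p.2) 0
  set κ : ℂ → ℂ := fun χ =>
    fderiv ℂ (fun p : ℂ × ℂ × ℂ => Q p.1 p.2.1 p.2.2) (0, χ, 0) (1, 0, 0) with hκ
  set A : ℂ → ℂ := fun χ => LF (1, κ χ) with hA
  set b : ℂ → ℂ := fun χ => fderiv ℂ (fun p : ℂ × ℂ => G p.1 p.2) (χ, 0) (0, 1) with hbdef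
  set B : ℂ → ℂ := fun χ => cj (b (cj χ)) with hB
  set φ : ℂ → ℂ := fun χ => cj (F (cj χ) 0) with hφ
  have hφa : AnalyticAt ℂ φ 0 := analyticAt_cj (f := fun z => F z 0) (hF.curry_left)
  have hφ0 : φ 0 = 0 := by simp [hφ, cj_zero, hF0]
  have hφd : deriv φ 0 ≠ 0 := by
    have h1 := AnalyticAt.hasDerivAt_apply_fst hF
    simp only [Prod.fst_zero, Prod.snd_zero] at h1
    rw [← cj_zero] at h1
    have h2 := (hasDerivAt_cj h1).deriv
    rw [cj_zero] at h2
    rw [hφ, h2]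
    exact (map_ne_zero (starRingEnd ℂ)).2 ha
  have hba : AnalyticAt ℂ b 0 := by
    have h1 : AnalyticAt ℂ (fun χ : ℂ => fderiv ℂ (fun p : ℂ × ℂ => G p.1 p.2) (χ, 0)) 0 :=
      hG.fderiv.curry_left
    exact ((ContinuousLinearMap.apply ℂ ℂ ((0, 1) : ℂ × ℂ)).analyticAt _).comp h1
  have hBa : AnalyticAt ℂ B 0 := analyticAt_cj hba
  have hB0 : B 0 ≠ 0 := by
    simp only [hB, cj_zero]
    exact (map_ne_zero (starRingEnd ℂ)).2 hd
  have hκa : AnalyticAt ℂ κ 0 := by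
    have h1 : AnalyticAt ℂ (fun χ : ℂ =>
        fderiv ℂ (fun p : ℂ × ℂ × ℂ => Q p.1 p.2.1 p.2.2) (0, χ, 0)) 0 :=
      hQ.1.fderiv.comp_of_eq (f := fun χ : ℂ => ((0, χ, 0) : ℂ × ℂ × ℂ))
        (analyticAt_const.prod (analyticAt_id.prod analyticAt_const)) rfl
    exact ((ContinuousLinearMap.apply ℂ ℂ ((1, 0, 0) : ℂ × ℂ × ℂ)).analyticAt _).comp h1
  have hAa : AnalyticAt ℂ A 0 := by
    have h1 : AnalyticAt ℂ (fun χ : ℂ => ((1, κ χ) : ℂ × ℂ)) 0 := analyticAt_const.prod hκa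
    exact (LF.analyticAt _).comp h1
  set D := (μ₀ + 1) * α₀ + (μ₀ + 2) * μ₀ with hD
  have c1 := tendsto_pow_punctured (n := μ₀ + 1) (by omega)
  have c2 := tendsto_pow_punctured (n := μ₀ + 2) (by omega)
  have hcurve : ∀ χ : ℂ, Tendsto (fun s : ℂ => ((s ^ (μ₀ + 1), χ, s ^ (μ₀ + 2)) : ℂ × ℂ × ℂ))
      (𝓝[≠] 0) (𝓝 (0, χ, 0)) := fun χ => c1.prodMk_nhds (tendsto_const_nhds.prodMk_nhds c2)
  have hcurve0 : ∀ χ : ℂ, Tendsto (fun s : ℂ => ((0, χ, s ^ (μ₀ + 2)) : ℂ × ℂ × ℂ))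
      (𝓝[≠] 0) (𝓝 (0, χ, 0)) :=
    fun χ => tendsto_const_nhds.prodMk_nhds (tendsto_const_nhds.prodMk_nhds c2)
  have hz0 : ∀ᶠ p : ℂ × ℂ × ℂ in 𝓝 0, Q 0 p.2.1 p.2.2 = p.2.2 := by
    have t1 : Tendsto (fun p : ℂ × ℂ × ℂ => p.2) (𝓝 0) (𝓝 0) :=
      Continuous.tendsto' (by fun_prop) _ _ rfl
    exact t1.eventually hQ.2.2.1
  have hQlim : ∀ᶠ χ in 𝓝 0, Tendsto (fun s : ℂ => Q (s ^ (μ₀ + 1)) χ (s ^ (μ₀ + 2)) /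
      s ^ (μ₀ + 1)) (𝓝[≠] 0) (𝓝 (κ χ)) := by
    filter_upwards [eventually_slice hQ.1.eventually_analyticAt, eventually_slice hz0]
      with χ h1 h2
    have h3 := h1.self_of_nhds.differentiableAt.hasFDerivAt
    have h4 : Q 0 χ 0 = 0 := h2.self_of_nhds
    have h5 := h3.tendsto_div_pow (d := fun s => (s ^ (μ₀ + 1), 0, s ^ (μ₀ + 2)))
      (N := μ₀ + 1) (v := (1, 0, 0)) h4 (hcurve 0) (by
        refine Tendsto.congr (fun s => ?_) ((tendsto_pow_div_pow (μ₀ + 1)).prodMk_nhds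
          ((tendsto_const_nhds (x := (0 : ℂ))).prodMk_nhds (tendsto_pow_succ_div_pow (μ₀ + 1))))
        simp [div_eq_inv_mul])
    simpa using h5
  have hκ0 : κ 0 = 0 := by
    have t : Tendsto (fun s : ℂ => ((s ^ (μ₀ + 1), s ^ (μ₀ + 2)) : ℂ × ℂ)) (𝓝[≠] 0) (𝓝 0) :=
      c1.prodMk_nhds c2
    refine tendsto_nhds_unique hQlim.self_of_nhds
      ((tendsto_pow_succ_div_pow (μ₀ + 1)).congr' ?_)
    filter_upwards [t.eventually hQ.2.1] with s hs
    rw [hs]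
  have hA0 : A 0 ≠ 0 := by
    simp only [hA, hκ0]
    exact ha
  have hφt : Tendsto φ (𝓝 0) (𝓝 0) := by
    have := hφa.continuousAt.tendsto
    rwa [hφ0] at this
  have hcjslice : ∀ {P : ℂ × ℂ → Prop}, (∀ᶠ p in 𝓝 0, P p) →
      ∀ᶠ χ : ℂ in 𝓝 0, P (cj χ, 0) := fun hP =>
    (tendsto_cj_zero.prodMk_nhds (tendsto_const_nhds (x := (0 : ℂ)))).eventually hP
  have hGbar : ∀ᶠ χ in 𝓝 0, Tendsto (fun s : ℂ => cj (G (cj χ) (cj (s ^ (μ₀ + 2)))) /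
      s ^ (μ₀ + 2)) (𝓝[≠] 0) (𝓝 (B χ)) := by
    filter_upwards [hcjslice hG.eventually_analyticAt, tendsto_cj_zero.eventually hGz]
      with χ h1 h2
    have h3 : HasDerivAt (G (cj χ)) (b (cj χ)) (cj 0) := by
      rw [cj_zero]
      exact AnalyticAt.hasDerivAt_apply_snd h1
    have h4 := (hasDerivAt_cj (f := G (cj χ)) h3).hasFDerivAt.tendsto_div_pow (N := μ₀ + 2) (v := 1)
      (d := fun s => s ^ (μ₀ + 2)) (by rw [cj_zero, h2, cj_zero]) c2
      (by simpa [div_eq_inv_mul] using tendsto_pow_div_pow (μ₀ + 2))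
    simpa [hB, hbdef] using h4
  have hFbar : ∀ᶠ χ in 𝓝 0, Tendsto (fun s : ℂ => cj (F (cj χ) (cj (s ^ (μ₀ + 2)))))
      (𝓝[≠] 0) (𝓝 (φ χ)) := by
    filter_upwards [hcjslice hF.eventually_analyticAt] with χ h1
    have t : Tendsto (fun s : ℂ => ((cj χ, cj (s ^ (μ₀ + 2))) : ℂ × ℂ)) (𝓝[≠] 0)
        (𝓝 (cj χ, 0)) := tendsto_const_nhds.prodMk_nhds (tendsto_cj_zero.comp c2)
    exact (continuous_cj.tendsto _).comp (h1.continuousAt.tendsto.comp t)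
  have hFder := hF.differentiableAt.hasFDerivAt
  have hM1 : ∀ᶠ χ in 𝓝 0, Tendsto (fun s : ℂ =>
      (G (s ^ (μ₀ + 1)) (Q (s ^ (μ₀ + 1)) χ (s ^ (μ₀ + 2))) -
        cj (G (cj χ) (cj (s ^ (μ₀ + 2))))) / s ^ D) (𝓝[≠] 0)
      (𝓝 (qd Q' α₀ μ₀ (φ χ) / (α₀.factorial : ℂ) / (μ₀.factorial : ℂ) *
        (A χ ^ α₀ * B χ ^ μ₀))) := by
    filter_upwards [hφt.eventually (hI'.eventually_tendsto hQ'), hQlim, hGbar, hFbar,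
      eventually_slice hmap] with χ h1 h2 h3 h4 h5
    have h6 := hFder.tendsto_div_pow (N := μ₀ + 1) (v := (1, κ χ)) hF0
      (d := fun s => (s ^ (μ₀ + 1), Q (s ^ (μ₀ + 1)) χ (s ^ (μ₀ + 2))))
      (c1.prodMk_nhds (tendsto_zero_of_tendsto_div_pow (by omega) h2)) (by
        refine Tendsto.congr (fun s => ?_) ((tendsto_pow_div_pow (μ₀ + 1)).prodMk_nhds h2)
        simp [div_eq_inv_mul])
    simp only [zero_add] at h6
    refine (h1 _ _ _ _ _ h4 h6 h3).congr' ?_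
    filter_upwards [(hcurve χ).eventually h5] with s hs
    rw [hs]
  have hM2 : ∀ᶠ χ in 𝓝 0, Tendsto (fun s : ℂ =>
      (G 0 (s ^ (μ₀ + 2)) - cj (G (cj χ) (cj (s ^ (μ₀ + 2))))) / s ^ D) (𝓝[≠] 0) (𝓝 0) := by
    filter_upwards [hφt.eventually (hI'.eventually_tendsto hQ'), hGbar, hFbar,
      eventually_slice (hmap.and hz0)] with χ h1 h3 h4 h5
    have h6 := hFder.tendsto_div_pow (N := μ₀ + 1) (v := 0) hF0
      (d := fun s => (0, s ^ (μ₀ + 2))) (tendsto_const_nhds.prodMk_nhds c2) (by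
        refine Tendsto.congr (fun s => ?_) ((tendsto_const_nhds (x := (0 : ℂ))).prodMk_nhds
          (tendsto_pow_succ_div_pow (μ₀ + 1)))
        simp [div_eq_inv_mul])
    simp only [zero_add, map_zero] at h6
    have h7 := h1 _ _ _ _ _ h4 h6 h3
    rw [zero_pow (by have := hI.1; omega), zero_mul, mul_zero] at h7
    refine h7.congr' ?_
    filter_upwards [(hcurve0 χ).eventually h5] with s hs
    obtain ⟨hs1, hs2⟩ := hs
    rw [hs2] at hs1
    rw [hs1]
  have hM3 : ∀ᶠ χ in 𝓝 0, Tendsto (fun s : ℂ =>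
      (G (s ^ (μ₀ + 1)) (Q (s ^ (μ₀ + 1)) χ (s ^ (μ₀ + 2))) -
        G (s ^ (μ₀ + 1)) (s ^ (μ₀ + 2))) / s ^ D) (𝓝[≠] 0)
      (𝓝 (LG (0, 1) * (qd Q α₀ μ₀ χ / (α₀.factorial : ℂ) / (μ₀.factorial : ℂ)))) := by
    filter_upwards [hI.eventually_tendsto hQ, hQlim] with χ h1 h2
    have h3 := h1 _ (fun _ => χ) _ _ _ tendsto_const_nhds (tendsto_pow_div_pow (μ₀ + 1))
      (tendsto_pow_div_pow (μ₀ + 2))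
    simp only [one_pow, mul_one] at h3
    exact hG.hasStrictFDerivAt.tendsto_sub_div_pow c1
      (tendsto_zero_of_tendsto_div_pow (by omega) h2) c2 h3
  have hq0 : qd Q' α₀ μ₀ 0 = 0 := qd_zero hQ' hI.1 μ₀
  have hM4 : Tendsto (fun s : ℂ => (G (s ^ (μ₀ + 1)) (s ^ (μ₀ + 2)) -
        cj (G (cj 0) (cj (s ^ (μ₀ + 2))))) / s ^ D) (𝓝[≠] 0) (𝓝 0) := by
    have h1 := hM1.self_of_nhds
    rw [hφ0, hq0, zero_div, zero_div, zero_mul] at h1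
    have t : Tendsto (fun s : ℂ => ((s ^ (μ₀ + 1), s ^ (μ₀ + 2)) : ℂ × ℂ)) (𝓝[≠] 0) (𝓝 0) :=
      c1.prodMk_nhds c2
    refine h1.congr' ?_
    filter_upwards [t.eventually hQ.2.1] with s hs
    rw [hs]
  refine ⟨φ, fun χ => A χ ^ α₀ * B χ ^ μ₀ * (LG (0, 1))⁻¹, hφa, hφ0, hφd,
    ((hAa.pow _).mul (hBa.pow _)).mul analyticAt_const,
    mul_ne_zero (mul_ne_zero (pow_ne_zero _ hA0) (pow_ne_zero _ hB0)) (inv_ne_zero hd), ?_⟩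
  filter_upwards [hM1, hM2, hM3] with χ h1 h2 h3
  have h4 := ((h1.sub h2).add hM2.self_of_nhds).sub hM4
  rw [sub_zero, add_zero, sub_zero] at h4
  have h5 := tendsto_nhds_unique h3 (h4.congr fun s => by ring)
  have f1 : (α₀.factorial : ℂ) ≠ 0 := by exact_mod_cast α₀.factorial_ne_zero
  have f2 : (μ₀.factorial : ℂ) ≠ 0 := by exact_mod_cast μ₀.factorial_ne_zero
  have hd' : LG (0, 1) ≠ 0 := hd
  field_simp at h5 ⊢
  linear_combination h5

/-- if `M, M'` are non-Levi-flat with the same invariants `(α₀, μ₀)`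
and some local biholomorphism sends `M` into `M'`, then the orders of vanishing at `0`
of `q_{α₀μ₀}` and `q'_{α₀μ₀}` coincide, are finite, and are at least `1` (the common
order `l` being detected by the iterated derivatives at `0`). -/
theorem vanishing_orders_coincide
    (Q Q' : ℂ → ℂ → ℂ → ℂ) (hQ : IsNormalCoord Q) (hQ' : IsNormalCoord Q')
    (hLF : NotLeviFlat Q) (hLF' : NotLeviFlat Q')
    (α₀ μ₀ : ℕ) (hI : IsInvariants Q α₀ μ₀) (hI' : IsInvariants Q' α₀ μ₀)
    (F G : ℂ → ℂ → ℂ) (h : SendsInto Q Q' F G) (hb : JacDet F G ≠ 0) :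
    ∃ l : ℕ, 1 ≤ l ∧
      (∀ j < l, deriv^[j] (qd Q α₀ μ₀) 0 = 0) ∧ deriv^[l] (qd Q α₀ μ₀) 0 ≠ 0 ∧
      (∀ j < l, deriv^[j] (qd Q' α₀ μ₀) 0 = 0) ∧ deriv^[l] (qd Q' α₀ μ₀) 0 ≠ 0 := by
  obtain ⟨φ, U, hφ, hφ0, hφd, hU, hU0, heq⟩ := h.exists_qd_eq hQ hQ' hI hI' hb
  have hqa := (analyticAt_qd hQ.1 α₀ μ₀).2
  have hqa' := (analyticAt_qd hQ'.1 α₀ μ₀).2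
  have hord : analyticOrderAt (qd Q α₀ μ₀) 0 = analyticOrderAt (qd Q' α₀ μ₀) 0 := by
    have hc : AnalyticAt ℂ (qd Q' α₀ μ₀ ∘ φ) 0 := hqa'.comp_of_eq hφ hφ0
    have e : qd Q α₀ μ₀ =ᶠ[𝓝 0] (qd Q' α₀ μ₀ ∘ φ) * U := heq
    rw [analyticOrderAt_congr e, analyticOrderAt_mul hc hU,
      hU.analyticOrderAt_eq_zero.2 hU0, add_zero,
      analyticOrderAt_comp_of_deriv_ne_zero hφ hφd, hφ0]
  have htop : analyticOrderAt (qd Q α₀ μ₀) 0 ≠ ⊤ := fun ht => hI.2.1 (analyticOrderAt_eq_top.1 ht)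
  obtain ⟨l, hl⟩ := ENat.ne_top_iff_exists.1 htop
  have h1 := (analyticOrderAt_eq_nat_iff_iteratedDeriv_eq_zero hqa).1 hl.symm
  have h2 := (analyticOrderAt_eq_nat_iff_iteratedDeriv_eq_zero hqa').1 (hl.trans hord).symm
  simp only [iteratedDeriv_eq_iterate] at h1 h2
  refine ⟨l, Nat.one_le_iff_ne_zero.2 ?_, h1.1, h1.2, h2.1, h2.2⟩
  rintro rfl
  exact h1.2 (qd_zero hQ hI.1 μ₀)
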